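/- arXiv:2410.14870 — 3 statements merged into one kernel-verified Lean document; each statement's English description precedes it below -/
import Mathlib

section
/- For y < 0, the contour integral F(y) := ∫_{C₁'} e^{iyz}/(z+i) dz, where C₁' is the ray {i + e^{−iπ/4} s : s ≥ 0} traversed from infinity toward the endpoint i, equals e^y (πi + Ei(−2y)), where Ei(k) = P.V.∫_{−∞}^k e^s/s ds is the exponential integral. -/
open MeasureTheory Complex Filter Set

/-- The exponential integral `Ei(k) = P.V. ∫_{-∞}^k e^s/s ds`, defined as the limit as
`δ ↓ 0` of `∫_{-∞}^{-δ} + ∫_δ^k`. -/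
noncomputable def Ei (k : ℝ) : ℝ :=
  limUnder (nhdsWithin 0 (Set.Ioi 0))
    (fun δ : ℝ => (∫ s in Set.Iic (-δ), Real.exp s / s) + ∫ s in δ..k, Real.exp s / s)

/-- The contour integral `F(y) = ∫_{C₁'} e^{iyz}/(z+i) dz`, where `C₁'` is the ray
`z = i + e^{-iπ/4}s`, `s ≥ 0`, traversed from infinity toward the endpoint `i`. -/
noncomputable def Fcontour (y : ℝ) : ℂ :=
  -∫ s in Set.Ioi (0 : ℝ),
      Complex.exp (Complex.I * y * (Complex.I + Complex.exp (-(Real.pi / 4) * Complex.I) * s)) /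
        ((Complex.I + Complex.exp (-(Real.pi / 4) * Complex.I) * s) + Complex.I) *
        Complex.exp (-(Real.pi / 4) * Complex.I)

lemma aux_H : ∃ H : ℂ → ℂ, (∀ w, I * w ∈ slitPlane → HasDerivAt H (Complex.exp w / w) w) ∧
    Tendsto (fun δ : ℝ => H (-(δ : ℂ)) - H δ) (nhdsWithin 0 (Set.Ioi 0))
      (nhds (-(Real.pi * I))) := by
  have hd : Differentiable ℂ (dslope Complex.exp 0) := by
    rw [← differentiableOn_univ, Complex.differentiableOn_dslope Filter.univ_mem]
    exact Complex.differentiable_exp.differentiableOn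
  obtain ⟨E, hE⟩ := hd.isExactOn_univ
  refine ⟨fun w => E w + Complex.log (I * w), ?_, ?_⟩
  · intro w hw
    have hw0 : w ≠ 0 := by
      rintro rfl
      simp at hw
    have h1 : HasDerivAt (fun w : ℂ => I * w) I w := by
      simpa using (hasDerivAt_id w).const_mul I
    have h2 := (hE w (mem_univ _)).add (h1.clog hw)
    refine h2.congr_deriv ?_
    rw [dslope_of_ne _ hw0, slope_def_field]
    simp
    field_simp
    ring
  · have hc : Continuous E := by
      rw [continuous_iff_continuousAt]
      exact fun w => (hE w (mem_univ _)).continuousAt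
    have h1 : Tendsto (fun δ : ℝ => E (-(δ : ℂ)) - E δ + (-(Real.pi * I)))
        (nhdsWithin 0 (Set.Ioi 0)) (nhds (-(Real.pi * I))) := by
      have : Continuous (fun δ : ℝ => E (-(δ : ℂ)) - E δ + (-(Real.pi * I))) := by fun_prop
      have := this.tendsto 0
      simp only [ofReal_zero, neg_zero, sub_self, zero_add] at this
      exact this.mono_left nhdsWithin_le_nhds
    refine h1.congr' ?_
    filter_upwards [self_mem_nhdsWithin] with δ hδ
    have hδ : 0 < δ := hδ
    have e1 : Complex.log (I * δ) = Real.log δ + Real.pi / 2 * I := by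
      rw [mul_comm, Complex.log_ofReal_mul hδ I_ne_zero, Complex.log_I]
    have e2 : Complex.log (I * -(δ : ℂ)) = Real.log δ - Real.pi / 2 * I := by
      rw [show I * -(δ : ℂ) = δ * -I by ring, 
        Complex.log_ofReal_mul hδ (neg_ne_zero.mpr I_ne_zero), Complex.log_neg_I]
      ring
    rw [e1, e2]
    ring

lemma aux_slit (k β s : ℝ) (hk : 0 < k) (hβ : β < 0) (hs : 0 ≤ s) :
    I * ((k : ℂ) + β * (1 + I) * s) ∈ slitPlane := by
  rw [Complex.mem_slitPlane_iff]
  rcases hs.eq_or_lt with rfl | h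
  · right
    simp [hk.ne']
  · left
    simp
    nlinarith

lemma aux_slit_real (x : ℝ) (hx : x ≠ 0) : I * (x : ℂ) ∈ slitPlane := by
  rw [Complex.mem_slitPlane_iff]
  right
  simpa using hx

lemma aux_int (k β : ℝ) (hk : 0 < k) (hβ : β < 0) :
    IntegrableOn (fun s : ℝ => Complex.exp ((k : ℂ) + β * (1 + I) * s) /
      ((k : ℂ) + β * (1 + I) * s) * (β * (1 + I))) (Set.Ioi 0) := by
  have hne : ∀ s : ℝ, 0 ≤ s → (k : ℂ) + β * (1 + I) * s ≠ 0 := by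
    intro s hs h
    have := aux_slit k β s hk hβ hs
    rw [h] at this
    simp at this
  have hc : ContinuousOn (fun s : ℝ => Complex.exp ((k : ℂ) + β * (1 + I) * s) /
      ((k : ℂ) + β * (1 + I) * s) * (β * (1 + I))) (Set.Ici 0) := by
    refine ContinuousOn.mul (ContinuousOn.div (by fun_prop) (by fun_prop) ?_) (by fun_prop)
    exact fun s hs => hne s hs
  refine (integrableOn_Ici_iff_integrableOn_Ioi (by finiteness)).mp ?_
  refine (hc.locallyIntegrableOn measurableSet_Ici).integrableOn_of_isBigO_atTop
    (g := fun s : ℝ => Real.exp (-(-β) * s)) ?_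
    ⟨Ioi 0, Ioi_mem_atTop 0, exp_neg_integrableOn_Ioi 0 (by linarith)⟩
  refine Asymptotics.IsBigO.of_bound (Real.exp k * ‖(β * (1 + I) : ℂ)‖) ?_
  filter_upwards [eventually_ge_atTop (1 / (-β)), eventually_ge_atTop 0] with s hs hs0
  have h1 : 1 ≤ ‖(k : ℂ) + β * (1 + I) * s‖ := by
    refine le_trans ?_ (Complex.abs_im_le_norm _)
    rw [div_le_iff₀ (by linarith)] at hs
    have : ((k : ℂ) + β * (1 + I) * s).im = β * s := by simp
    rw [this, abs_of_nonpos (by nlinarith)]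
    nlinarith
  rw [norm_mul, norm_div, Complex.norm_exp]
  have h2 : ((k : ℂ) + β * (1 + I) * s).re = k + β * s := by simp
  rw [h2, Real.exp_add, Real.norm_of_nonneg (Real.exp_pos _).le, neg_neg]
  have h3 : Real.exp k * Real.exp (β * s) / ‖(k : ℂ) + β * (1 + I) * s‖ 
      ≤ Real.exp k * Real.exp (β * s) := div_le_self (by positivity) h1
  calc _ ≤ Real.exp k * Real.exp (β * s) * ‖(β * (1 + I) : ℂ)‖ := by gcongr
    _ = _ := by ring

lemma aux_Ei (k β : ℝ) (hk : 0 < k) (hβ : β < 0) :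
    ((Ei k : ℝ) : ℂ) = -(∫ s in Set.Ioi (0 : ℝ), Complex.exp ((k : ℂ) + β * (1 + I) * s) /
      ((k : ℂ) + β * (1 + I) * s) * (β * (1 + I))) - Real.pi * I := by
  obtain ⟨H, hH, hH0⟩ := aux_H
  have hint := aux_int k β hk hβ
  set f : ℝ → ℂ := fun s : ℝ => Complex.exp ((k : ℂ) + β * (1 + I) * s) /
      ((k : ℂ) + β * (1 + I) * s) * (β * (1 + I)) with hf
  set A := H k + ∫ s in Set.Ioi (0 : ℝ), f s with hA
  have hB : Tendsto (fun s : ℝ => H ((k : ℂ) + β * (1 + I) * s)) atTop (nhds A) := by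
    have h1 := (intervalIntegral_tendsto_integral_Ioi 0 hint tendsto_id).const_add (H k)
    refine h1.congr' ?_
    filter_upwards [eventually_ge_atTop 0] with T hT
    have h2 : ∫ s in (0 : ℝ)..T, f s = H ((k : ℂ) + β * (1 + I) * T) -
        H ((k : ℂ) + β * (1 + I) * (0 : ℝ)) := by
      refine intervalIntegral.integral_eq_sub_of_hasDerivAt
        (f := fun s : ℝ => H ((k : ℂ) + β * (1 + I) * s)) ?_ ?_
      · intro s hs
        rw [uIcc_of_le hT] at hs
        have h3 : HasDerivAt (fun s : ℝ => (k : ℂ) + β * (1 + I) * s) (β * (1 + I)) s := by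
          simpa using ((hasDerivAt_id s).ofReal_comp.const_mul (β * (1 + I) : ℂ)).const_add (k : ℂ)
        exact (hH _ (aux_slit k β s hk hβ hs.1)).comp s h3
      · rw [intervalIntegrable_iff_integrableOn_Ioc_of_le hT]
        exact hint.mono_set Ioc_subset_Ioi_self
    simp only [id]
    rw [h2]
    simp
  have hC : Tendsto (fun x : ℝ => H (x : ℂ)) atBot (nhds A) := by
    have h1 : Tendsto (fun x : ℝ => (x - k) / β) atBot atTop := by
      have : Tendsto (fun x : ℝ => x - k) atBot atBot := tendsto_atBot_add_const_right _ _ tendsto_id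
      simp only [div_eq_mul_inv]
      exact this.atBot_mul_const_of_neg (inv_lt_zero.mpr hβ)
    have h2 := hB.comp h1
    have h3 : Tendsto (fun x : ℝ => H (x : ℂ) -
        H ((k : ℂ) + β * (1 + I) * (((x - k) / β : ℝ) : ℂ))) atBot (nhds 0) := by
      have hz : Tendsto (fun x : ℝ => Real.exp x * (k - x)) atBot (nhds 0) := by
        have a1 : Tendsto (fun x : ℝ => Real.exp x * k) atBot (nhds 0) := by
          simpa using Real.tendsto_exp_atBot.mul_const k
        have a2 : Tendsto (fun x : ℝ => x ^ 1 * Real.exp (-x)) atTop (nhds 0) :=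
          Real.tendsto_pow_mul_exp_neg_atTop_nhds_zero 1
        have a3 := a1.add (a2.comp tendsto_neg_atBot_atTop)
        rw [add_zero] at a3
        refine a3.congr fun x => ?_
        simp
        ring
      refine squeeze_zero_norm' ?_ hz
      filter_upwards [eventually_le_atBot (-1), eventually_le_atBot k] with x hx hxk
      have hpt : (k : ℂ) + β * (1 + I) * (((x - k) / β : ℝ) : ℂ) = x + (x - k : ℝ) * I := by
        have : (β : ℂ) ≠ 0 := by exact_mod_cast hβ.ne
        push_cast
        field_simp
        ring
      rw [hpt]
      have hmv := Convex.norm_image_sub_le_of_norm_hasDerivWithin_le (𝕜 := ℂ) (f := H)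
        (f' := fun w => Complex.exp w / w) (C := Real.exp x)
        (s := {w : ℂ | w.re ≤ x} ∩ {w : ℂ | w.im ≤ 0}) (x := x + (x - k : ℝ) * I) (y := (x : ℂ))
        ?_ ?_ ?_ ?_ ?_
      · refine hmv.trans_eq ?_
        congr 1
        rw [sub_add_cancel_left, norm_neg, norm_mul, Complex.norm_I, mul_one, Complex.norm_real,
          Real.norm_eq_abs, abs_of_nonpos (by linarith)]
        ring
      · intro w hw
        refine (hH w ?_).hasDerivWithinAt
        rw [Complex.mem_slitPlane_iff]
        right
        have : w.re ≤ x := hw.1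
        have : w.re ≠ 0 := by linarith
        simpa using this
      · intro w hw
        have h5 : w.re ≤ x := hw.1
        rw [norm_div, Complex.norm_exp]
        have h6 : 1 ≤ ‖w‖ := by
          refine le_trans ?_ (Complex.abs_re_le_norm _)
          rw [abs_of_nonpos (by linarith)]
          linarith
        exact (div_le_self (Real.exp_pos _).le h6).trans (Real.exp_le_exp.mpr h5)
      · exact (convex_halfSpace_re_le x).inter (convex_halfSpace_im_le 0)
      · simp [hxk]
      · simp
    have h4 := h3.add h2
    rw [zero_add] at h4
    refine h4.congr fun x => ?_
    simp
  have hD : ∀ x : ℝ, x ≠ 0 → HasDerivAt (fun x : ℝ => H (x : ℂ))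
      ((Real.exp x / x : ℝ) : ℂ) x := by
    intro x hx
    have := (hH x (aux_slit_real x hx)).comp_ofReal
    push_cast
    exact this
  have hL : Tendsto (fun δ : ℝ => (((∫ s in Set.Iic (-δ), Real.exp s / s) +
      ∫ s in δ..k, Real.exp s / s : ℝ) : ℂ)) (nhdsWithin 0 (Set.Ioi 0))
      (nhds (H k - A - Real.pi * I)) := by
    have h1 := hH0.const_add (H k - A)
    rw [← sub_eq_add_neg] at h1
    refine h1.congr' ?_
    filter_upwards [Ioo_mem_nhdsGT hk] with δ hδ
    have hi : IntegrableOn (fun s : ℝ => Real.exp s / s) (Set.Iic (-δ)) := by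
      refine Integrable.mono' ((integrableOn_exp_Iic (-δ)).div_const δ) ?_ ?_
      · exact (by fun_prop : Measurable fun s : ℝ => Real.exp s / s).aestronglyMeasurable
      · refine (ae_restrict_iff' measurableSet_Iic).mpr (Eventually.of_forall fun s hs => ?_)
        have hs : s ≤ -δ := hs
        rw [norm_div, Real.norm_of_nonneg (Real.exp_pos _).le, Real.norm_eq_abs]
        have := hδ.1
        gcongr
        rw [abs_of_nonpos (by linarith)]
        linarith
    have e1 : ∫ s in Set.Iic (-δ), ((Real.exp s / s : ℝ) : ℂ) = H ((-δ : ℝ) : ℂ) - A := by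
      refine integral_Iic_of_hasDerivAt_of_tendsto' (f := fun x : ℝ => H (x : ℂ)) ?_ hi.ofReal hC
      intro x hx
      have hx : x ≤ -δ := hx
      exact hD x (by linarith [hδ.1])
    have e2 : ∫ s in δ..k, ((Real.exp s / s : ℝ) : ℂ) = H k - H δ := by
      have hmem : ∀ x ∈ uIcc δ k, x ≠ 0 := by
        intro x hx
        rw [uIcc_of_le hδ.2.le] at hx
        linarith [hx.1, hδ.1]
      refine intervalIntegral.integral_eq_sub_of_hasDerivAt (f := fun x : ℝ => H (x : ℂ))
        (fun x hx => hD x (hmem x hx)) ?_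
      refine ContinuousOn.intervalIntegrable ?_
      refine Complex.continuous_ofReal.comp_continuousOn ?_
      exact ContinuousOn.div (by fun_prop) (by fun_prop) hmem
    have e3 : ((∫ s in Set.Iic (-δ), Real.exp s / s : ℝ) : ℂ) = H ((-δ : ℝ) : ℂ) - A :=
      integral_complex_ofReal.symm.trans e1
    have e4 : ((∫ s in δ..k, Real.exp s / s : ℝ) : ℂ) = H k - H δ :=
      intervalIntegral.integral_ofReal.symm.trans e2
    rw [ofReal_add, e3, e4]
    push_cast
    ring
  have hre := (Complex.continuous_re.tendsto _).comp hL
  have hEi : Ei k = (H k - A - Real.pi * I).re := by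
    refine Tendsto.limUnder_eq ?_
    exact hre
  have hcast := (Complex.continuous_ofReal.tendsto _).comp hre
  have := tendsto_nhds_unique hcast hL
  rw [hEi, this, hA]
  ring

/-- For `y < 0`, `F(y) = e^y (πi + Ei(-2y))`. -/
theorem stmt5 (y : ℝ) (hy : y < 0) :
    Fcontour y = Real.exp y * (Real.pi * Complex.I + (Ei (-2 * y) : ℝ)) := by
  have hs2 : 0 < Real.sqrt 2 / 2 := by positivity
  have hβ : y * (Real.sqrt 2 / 2) < 0 := by nlinarith
  have hE : Complex.exp (-(Real.pi / 4) * I) = ((Real.sqrt 2 / 2 : ℝ) : ℂ) * (1 - I) := by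
    have : (-(Real.pi / 4) * I : ℂ) = ((-(Real.pi / 4) : ℝ) : ℂ) * I := by push_cast; ring
    rw [this, Complex.exp_mul_I, ← Complex.ofReal_cos, ← Complex.ofReal_sin, Real.cos_neg,
      Real.sin_neg, Real.cos_pi_div_four, Real.sin_pi_div_four]
    push_cast
    ring
  rw [aux_Ei (-2 * y) (y * (Real.sqrt 2 / 2)) (by linarith) hβ]
  unfold Fcontour
  rw [add_sub_cancel, mul_neg, ← integral_const_mul]
  congr 1
  refine setIntegral_congr_fun measurableSet_Ioi fun s hs => ?_
  have hy0 : (y : ℂ) ≠ 0 := by exact_mod_cast hy.ne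
  simp only [hE]
  generalize Real.sqrt 2 / 2 = r
  have hw : (((-2 * y : ℝ) : ℂ) + ((y * r : ℝ) : ℂ) * (1 + I) * s)
      = I * y * ((I + (r : ℂ) * (1 - I) * s) + I) := by
    push_cast
    linear_combination (- 2 * (y : ℂ) + y * r * s) * I_mul_I
  have hb : ((y * r : ℝ) : ℂ) * (1 + I) = I * y * (r * (1 - I)) := by
    push_cast
    linear_combination (y * r : ℂ) * I_mul_I
  have he : Complex.exp (I * y * (I + (r : ℂ) * (1 - I) * s)) =
      Real.exp y * Complex.exp (I * y * ((I + (r : ℂ) * (1 - I) * s) + I)) := by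
    rw [Complex.ofReal_exp, ← Complex.exp_add]
    congr 1
    linear_combination (- y : ℂ) * I_mul_I
  rw [hw, hb, he]
  have hIy : I * (y : ℂ) ≠ 0 := mul_ne_zero I_ne_zero hy0
  rw [div_mul_eq_mul_div, div_mul_eq_mul_div, mul_left_comm _ (I * (y : ℂ)) _,
    mul_div_mul_left _ _ hIy]
  ring
end

section
/- For λ > 0, let C be a contour from e^{−3iπ/4}∞ to e^{−iπ/4}∞ passing above the point −i. Then n(λ) := −i ∫_C [(x−i)/(x+i)²] e^{−iλx} (∫_x^{−i} e^{iλz}/(z−i) dz) dx = 2π, where the inner integral is along the straight segment from x to −i. -/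
open MeasureTheory Complex Filter Set

/-- A contour from `e^{-3iπ/4}∞` to `e^{-iπ/4}∞` passing above `-i`:
`γ(s) = s - i(√(1+s²) - 1)`. -/
noncomputable def gammaC (s : ℝ) : ℂ := (s : ℂ) - Complex.I * (Real.sqrt (1 + s ^ 2) - 1)

/-- The derivative of the parametrization `gammaC`. -/
noncomputable def gammaC' (s : ℝ) : ℂ := 1 - Complex.I * (s / Real.sqrt (1 + s ^ 2))

/-- The inner integral `∫_x^{-i} e^{iλz}/(z-i) dz` along the straight segment
`z = x - r(x+i)`, `0 ≤ r ≤ 1`. -/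
noncomputable def innerInt (lam : ℝ) (x : ℂ) : ℂ :=
  ∫ r : ℝ in (0)..1,
    Complex.exp (Complex.I * lam * (x - r * (x + Complex.I))) /
        ((x - r * (x + Complex.I)) - Complex.I) * (-(x + Complex.I))

noncomputable def ww (s : ℝ) : ℂ := gammaC s + Complex.I

lemma ww_re (s : ℝ) : (ww s).re = s := by
  simp [ww, gammaC]

lemma ww_im (s : ℝ) : (ww s).im = 2 - Real.sqrt (1 + s ^ 2) := by
  simp [ww, gammaC]; ring

lemma abs_le_sqrt (s : ℝ) : |s| ≤ Real.sqrt (1 + s ^ 2) := by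
  apply Real.le_sqrt_of_sq_le; rw [sq_abs]; linarith

lemma one_le_sqrt' (s : ℝ) : 1 ≤ Real.sqrt (1 + s ^ 2) := by
  apply Real.le_sqrt_of_sq_le; nlinarith [sq_nonneg s]

lemma ww_im_le (s : ℝ) : (ww s).im ≤ 2 - |s| := by
  rw [ww_im]; linarith [abs_le_sqrt s]

lemma ww_im_le_one (s : ℝ) : (ww s).im ≤ 1 := by
  rw [ww_im]; linarith [one_le_sqrt' s]

lemma ww_norm (s : ℝ) : (1 + |s|) / 4 ≤ ‖ww s‖ := by
  rcases le_total |s| 1 with h | h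
  · have h1 : Real.sqrt (1 + s ^ 2) ≤ 3 / 2 := by
      apply Real.sqrt_le_iff.2 ⟨by norm_num, ?_⟩
      have := sq_abs s
      nlinarith [abs_nonneg s]
    have h2 := Complex.abs_im_le_norm (ww s)
    have h3 := le_abs_self (ww s).im
    rw [ww_im] at h2 h3
    linarith
  · have h2 := Complex.abs_re_le_norm (ww s)
    rw [ww_re] at h2
    linarith

lemma ww_ne (s : ℝ) : ww s ≠ 0 := by
  have := ww_norm s
  have h2 := abs_nonneg s
  exact norm_pos_iff.1 (by linarith)

lemma ww_sub_norm (s : ℝ) (c : ℂ) (hr : c.re = 0) (hc : 2 ≤ c.im) :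
    (1 + |s|) / 2 ≤ ‖ww s - c‖ := by
  have h1 := Complex.abs_re_le_norm (ww s - c)
  have h2 := Complex.abs_im_le_norm (ww s - c)
  have h3 := neg_abs_le (ww s - c).im
  have h4 := ww_im_le_one s
  simp only [Complex.sub_re, Complex.sub_im, ww_re, hr, sub_zero] at h1 h2 h3
  linarith

lemma ww_deriv (s : ℝ) : HasDerivAt ww (gammaC' s) s := by
  have hpos : 0 < 1 + s ^ 2 := by positivity
  have h1 : HasDerivAt (fun s : ℝ => Real.sqrt (1 + s ^ 2)) (s / Real.sqrt (1 + s ^ 2)) s := by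
    have := (((hasDerivAt_pow 2 s)).const_add 1).sqrt hpos.ne'
    convert this using 1
    have := one_le_sqrt' s
    field_simp
    norm_num
    ring
  have h2 : HasDerivAt (fun s : ℝ => (s : ℂ)) 1 s := Complex.ofRealCLM.hasDerivAt
  have h3 := ((h2.sub ((h1.ofReal_comp.sub_const 1).const_mul Complex.I)).add_const Complex.I)
  unfold ww gammaC gammaC'
  exact h3.congr_deriv (by push_cast; rfl)

lemma ww_cont : Continuous ww :=
  continuous_iff_continuousAt.2 fun s => (ww_deriv s).continuousAt

lemma gammaC'_cont : Continuous gammaC' := by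
  unfold gammaC'
  have : ∀ s : ℝ, (Real.sqrt (1 + s ^ 2) : ℂ) ≠ 0 := fun s => by
    have := one_le_sqrt' s
    exact_mod_cast (by linarith : Real.sqrt (1 + s ^ 2) ≠ 0)
  fun_prop (disch := simpa using this)

lemma gammaC'_norm (s : ℝ) : ‖gammaC' s‖ ≤ 2 := by
  unfold gammaC'
  have h := one_le_sqrt' s
  refine (norm_sub_le _ _).trans ?_
  rw [norm_mul, Complex.norm_I, ← Complex.ofReal_div, Complex.norm_real, norm_one, Real.norm_eq_abs,
    abs_div, abs_of_pos (by linarith : 0 < Real.sqrt (1 + s ^ 2))]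
  have : |s| / Real.sqrt (1 + s ^ 2) ≤ 1 := (div_le_one (by linarith)).2 (abs_le_sqrt s)
  linarith

lemma exp_norm (a : ℝ) (z : ℂ) : ‖Complex.exp (-Complex.I * a * z)‖ = Real.exp (a * z.im) := by
  rw [Complex.norm_exp]; congr 1; simp

lemma int_exp (a : ℝ) (ha : 0 < a) : Integrable (fun s : ℝ => Real.exp (-a * |s|)) := by
  rw [← integrableOn_univ, ← Set.Iic_union_Ioi (a := (0:ℝ))]
  refine IntegrableOn.union ?_ ?_
  · refine (integrableOn_exp_mul_Iic ha 0).congr_fun ?_ measurableSet_Iic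
    intro x hx; simp only [Set.mem_Iic] at hx; simp [abs_of_nonpos hx]
  · refine (integrableOn_exp_mul_Ioi (neg_neg_of_pos ha) 0).congr_fun ?_ measurableSet_Ioi
    intro x hx; simp only [Set.mem_Ioi] at hx; simp [abs_of_pos hx]

lemma exp_bound (a : ℝ) (ha : 0 < a) (c : ℂ) (s : ℝ) :
    ‖Complex.exp (-Complex.I * a * (ww s - c))‖ ≤
      Real.exp (a * (2 - c.im)) * Real.exp (-a * |s|) := by
  rw [exp_norm, ← Real.exp_add, Real.exp_le_exp]
  have := ww_im_le s
  simp only [Complex.sub_im]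
  nlinarith

lemma int_E (a : ℝ) (ha : 0 < a) (c : ℂ) :
    Integrable (fun s : ℝ => Complex.exp (-Complex.I * a * (ww s - c)) * gammaC' s) := by
  refine ((int_exp a ha).const_mul (Real.exp (a * (2 - c.im)) * 2)).mono' ?_ ?_
  · have := ww_cont; have := gammaC'_cont
    exact Continuous.aestronglyMeasurable (by fun_prop)
  · refine Filter.Eventually.of_forall fun s => ?_
    rw [norm_mul]
    have h1 := exp_bound a ha c s
    have h2 := gammaC'_norm s
    calc _ ≤ (Real.exp (a * (2 - c.im)) * Real.exp (-a * |s|)) * 2 := by gcongr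
      _ = _ := by ring

lemma tendsto_E (a : ℝ) (ha : 0 < a) (c : ℂ) (l : Filter ℝ) (hl : Tendsto (fun s : ℝ => |s|) l atTop) :
    Tendsto (fun s : ℝ => Complex.exp (-Complex.I * a * (ww s - c))) l (nhds 0) := by
  apply squeeze_zero_norm (exp_bound a ha c)
  have : Tendsto (fun s : ℝ => Real.exp (-a * |s|)) l (nhds 0) := by
    apply Real.tendsto_exp_atBot.comp
    exact hl.const_mul_atTop_of_neg (neg_neg_of_pos ha)
  simpa using this.const_mul (Real.exp (a * (2 - c.im)))

lemma integral_E (a : ℝ) (ha : 0 < a) (c : ℂ) :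
    ∫ s : ℝ, Complex.exp (-Complex.I * a * (ww s - c)) * gammaC' s = 0 := by
  have ha' : (a : ℂ) ≠ 0 := by exact_mod_cast ha.ne'
  have hd : ∀ s : ℝ, HasDerivAt
      (fun s : ℝ => Complex.exp (-Complex.I * a * (ww s - c)) * (-Complex.I * a)⁻¹)
      (Complex.exp (-Complex.I * a * (ww s - c)) * gammaC' s) s := by
    intro s
    have := ((((ww_deriv s).sub_const c).const_mul (-Complex.I * a)).cexp).mul_const
      (-Complex.I * a)⁻¹
    refine this.congr_deriv ?_
    have := Complex.I_ne_zero
    field_simp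
  have := integral_of_hasDerivAt_of_tendsto hd (int_E a ha c)
    (m := 0) (n := 0) ?_ ?_
  · simpa using this
  · simpa using (tendsto_E a ha c atBot tendsto_abs_atBot_atTop).mul_const (-Complex.I * a)⁻¹
  · simpa using (tendsto_E a ha c atTop tendsto_abs_atTop_atTop).mul_const (-Complex.I * a)⁻¹

noncomputable def MM (c : ℂ) (a : ℝ) : ℂ :=
  ∫ s : ℝ, Complex.exp (-Complex.I * a * (ww s - c)) / (ww s - c) * gammaC' s

lemma int_M (a : ℝ) (ha : 0 < a) (c : ℂ) (δ : ℝ) (hδ : 0 < δ) (hc : ∀ s, δ ≤ ‖ww s - c‖) :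
    Integrable (fun s : ℝ => Complex.exp (-Complex.I * a * (ww s - c)) / (ww s - c) * gammaC' s) := by
  have hne : ∀ s, ww s - c ≠ 0 := fun s => norm_pos_iff.1 (hδ.trans_le (hc s))
  refine ((int_E a ha c).norm.const_mul δ⁻¹).mono' ?_ ?_
  · have := ww_cont; have := gammaC'_cont
    exact Continuous.aestronglyMeasurable (by fun_prop (disch := simpa using hne))
  · refine Filter.Eventually.of_forall fun s => ?_
    rw [norm_mul, norm_div, norm_mul, div_eq_inv_mul, mul_assoc]
    have := hc s
    gcongr

lemma MM_deriv (a : ℝ) (ha : 0 < a) (c : ℂ) (δ : ℝ) (hδ : 0 < δ) (hc : ∀ s, δ ≤ ‖ww s - c‖) :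
    HasDerivAt (MM c) 0 a := by
  have hne : ∀ s, ww s - c ≠ 0 := fun s => norm_pos_iff.1 (hδ.trans_le (hc s))
  have key := hasDerivAt_integral_of_dominated_loc_of_deriv_le (μ := volume) (𝕜 := ℝ) (x₀ := a)
    (s := Set.Ioo (a/2) (2*a))
    (F := fun a s => Complex.exp (-Complex.I * a * (ww s - c)) / (ww s - c) * gammaC' s)
    (F' := fun a s => -Complex.I * (Complex.exp (-Complex.I * a * (ww s - c)) * gammaC' s))
    (bound := fun s => Real.exp (2 * a * |2 - c.im|) * 2 * Real.exp (- (a/2) * |s|))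
    (Ioo_mem_nhds (by linarith) (by linarith)) ?_ (int_M a ha c δ hδ hc)
    ((int_E a ha c).const_mul _).aestronglyMeasurable ?_ ?_ ?_
  · have h := key.2
    rw [integral_const_mul, integral_E a ha c, mul_zero] at h
    exact h
  · refine Filter.Eventually.of_forall fun x => ?_
    have := ww_cont; have := gammaC'_cont
    exact Continuous.aestronglyMeasurable (by fun_prop (disch := simpa using hne))
  · refine Filter.Eventually.of_forall fun s x hx => ?_
    have h1 := exp_bound x (by linarith [hx.1]) c s
    have h2 := gammaC'_norm s
    rw [norm_mul, norm_neg, Complex.norm_I, one_mul, norm_mul]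
    have h3 : x * (2 - c.im) ≤ 2 * a * |2 - c.im| :=
      calc _ ≤ x * |2 - c.im| := by
            have := hx.1
            gcongr
            · linarith
            · exact le_abs_self _
        _ ≤ _ := by have := hx.2; gcongr
    have h4 : -x * |s| ≤ - (a/2) * |s| := by have := hx.1; gcongr
    calc _ ≤ (Real.exp (x * (2 - c.im)) * Real.exp (-x * |s|)) * 2 := by gcongr
      _ ≤ (Real.exp (2 * a * |2 - c.im|) * Real.exp (- (a/2) * |s|)) * 2 := by gcongr
      _ = _ := by ring
  · exact (int_exp (a/2) (by linarith)).const_mul _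
  · refine Filter.Eventually.of_forall fun s x hx => ?_
    have h2 : HasDerivAt (fun s : ℝ => (s : ℂ)) 1 x := Complex.ofRealCLM.hasDerivAt
    have := ((((h2.const_mul (-Complex.I)).mul_const (ww s - c)).cexp).div_const
      (ww s - c)).mul_const (gammaC' s)
    refine this.congr_deriv ?_
    have := hne s
    field_simp

lemma MM_const (c : ℂ) (δ : ℝ) (hδ : 0 < δ) (hc : ∀ s, δ ≤ ‖ww s - c‖) (a b : ℝ)
    (ha : 0 < a) (hb : 0 < b) : MM c a = MM c b := by
  refine isOpen_Ioi.is_const_of_deriv_eq_zero (s := Set.Ioi (0:ℝ)) isPreconnected_Ioi ?_ ?_ ha hb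
  · exact fun x hx => (MM_deriv x hx c δ hδ hc).differentiableAt.differentiableWithinAt
  · exact fun x hx => (MM_deriv x hx c δ hδ hc).deriv

lemma MM_zero (c : ℂ) (hr : c.re = 0) (hc : 2 ≤ c.im) (a : ℝ) (ha : 0 < a) : MM c a = 0 := by
  have hδ : ∀ s, (1/2 : ℝ) ≤ ‖ww s - c‖ := fun s => by
    have := ww_sub_norm s c hr hc
    have := abs_nonneg s
    linarith
  set C := ∫ s : ℝ, 4 * Real.exp (-1 * |s|) with hC
  have hb : ∀ b : ℝ, 0 ≤ b → ‖MM c a‖ ≤ Real.exp (-b) * C := by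
    intro b hb0
    rw [MM_const c (1/2) (by norm_num) hδ a (b + 1) ha (by linarith), MM, hC, ← integral_const_mul]
    refine norm_integral_le_of_norm_le (((int_exp 1 one_pos).const_mul _).const_mul _) ?_
    refine Filter.Eventually.of_forall fun s => ?_
    rw [norm_mul, norm_div, exp_norm]
    have h1 := ww_im_le s
    have h2 := ww_im_le_one s
    have h3 : Real.exp ((b+1) * (ww s - c).im) ≤ Real.exp (-b) * Real.exp (-1 * |s|) := by
      rw [← Real.exp_add, Real.exp_le_exp, Complex.sub_im]
      nlinarith
    have h4 := gammaC'_norm s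
    have h5 := hδ s
    calc _ ≤ (Real.exp (-b) * Real.exp (-1 * |s|)) / (1/2) * 2 := by gcongr
      _ = _ := by ring
  have ht : Tendsto (fun b : ℝ => Real.exp (-b) * C) atTop (nhds 0) := by
    simpa using (Real.tendsto_exp_neg_atTop_nhds_zero).mul_const C
  have := ge_of_tendsto ht (Filter.eventually_atTop.2 ⟨0, fun b hb' => hb b hb'⟩)
  exact norm_le_zero_iff.1 this

lemma log_neg_sub (z : ℂ) (hz : 0 < z.im) : Complex.log (-z) - Complex.log z = -(Real.pi * Complex.I) := by
  simp only [Complex.log, norm_neg, Complex.arg_neg_eq_arg_sub_pi_of_im_pos hz]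
  push_cast; ring

noncomputable def PP (s : ℝ) : ℂ := Complex.log (-Complex.I * ww s) - Complex.log (Complex.I * (ww s - 2 * Complex.I))

lemma slit1 (s : ℝ) : -Complex.I * ww s ∈ Complex.slitPlane := by
  rw [Complex.mem_slitPlane_iff]
  by_cases h : s = 0
  · left; simp [ww_im, h]
  · right; simpa [ww_re] using h

lemma slit2 (s : ℝ) : Complex.I * (ww s - 2 * Complex.I) ∈ Complex.slitPlane := by
  rw [Complex.mem_slitPlane_iff]
  left
  have := one_le_sqrt' s
  have h : (Complex.I * (ww s - 2 * Complex.I)).re = Real.sqrt (1 + s ^ 2) := by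
    simp [ww_im]
  rw [h]; linarith

lemma PP_deriv (s : ℝ) : HasDerivAt PP ((1 / ww s - 1 / (ww s - 2 * Complex.I)) * gammaC' s) s := by
  have h1 := ((ww_deriv s).const_mul (-Complex.I)).clog_real (slit1 s)
  have h2 := (((ww_deriv s).sub_const (2 * Complex.I)).const_mul (Complex.I)).clog_real (slit2 s)
  refine (h1.sub h2).congr_deriv ?_
  have h3 := ww_ne s
  have h4 := right_ne_zero_of_mul (Complex.slitPlane_ne_zero (slit2 s))
  have := Complex.I_ne_zero
  field_simp

lemma PP_scale (s t : ℝ) (ht : 0 < t) : PP s = Complex.log (-Complex.I * ww s * (t⁻¹ : ℝ)) -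
    Complex.log (Complex.I * (ww s - 2 * Complex.I) * (t⁻¹ : ℝ)) := by
  have ht' := inv_pos.2 ht
  rw [mul_comm _ ((t⁻¹ : ℝ) : ℂ), mul_comm _ ((t⁻¹ : ℝ) : ℂ),
    Complex.log_ofReal_mul ht' (Complex.slitPlane_ne_zero (slit1 s)),
    Complex.log_ofReal_mul ht' (Complex.slitPlane_ne_zero (slit2 s)), PP]
  ring

lemma sqrt_tendsto (l : Filter ℝ) (hl : Tendsto (fun s : ℝ => |s|) l atTop) :
    Tendsto (fun s : ℝ => Real.sqrt (1 + s ^ 2) * |s|⁻¹) l (nhds 1) := by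
  have h1 : Tendsto (fun s : ℝ => |s|⁻¹) l (nhds 0) := tendsto_inv_atTop_zero.comp hl
  have h2 : Tendsto (fun s : ℝ => Real.sqrt ((|s|⁻¹)^2 + 1)) l (nhds 1) := by
    have := ((h1.pow 2).add_const 1).sqrt
    simpa using this
  refine h2.congr' ?_
  filter_upwards [hl.eventually_gt_atTop 0] with s hs
  have : (|s|⁻¹)^2 + 1 = (1 + s^2) * (|s|⁻¹)^2 := by
    rw [← sq_abs s]; field_simp
  rw [this, Real.sqrt_mul (by positivity), Real.sqrt_sq (by positivity)]

lemma ww_eq (s : ℝ) : ww s = s + (2 - Real.sqrt (1 + s ^ 2)) * Complex.I := by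
  simp [ww, gammaC]; ring

lemma PP_lim (l : Filter ℝ) (e : ℝ) (he : e ≠ 0) (hl : Tendsto (fun s : ℝ => |s|) l atTop)
    (hs : ∀ᶠ s in l, s * |s|⁻¹ = e) :
    Tendsto PP l (nhds (Complex.log (-(1 + e * Complex.I)) - Complex.log (1 + e * Complex.I))) := by
  have h1 : Tendsto (fun s : ℝ => ((|s|⁻¹ : ℝ) : ℂ)) l (nhds ((0 : ℝ) : ℂ)) :=
    (Complex.continuous_ofReal.tendsto 0).comp (tendsto_inv_atTop_zero.comp hl)
  have h2 : Tendsto (fun s : ℝ => ((Real.sqrt (1 + s ^ 2) * |s|⁻¹ : ℝ) : ℂ)) l (nhds ((1 : ℝ) : ℂ)) :=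
    (Complex.continuous_ofReal.tendsto 1).comp (sqrt_tendsto l hl)
  have hB : Tendsto (fun s : ℝ => Complex.I * (ww s - 2 * Complex.I) * (|s|⁻¹ : ℝ)) l
      (nhds (1 + e * Complex.I)) := by
    have := h2.add_const (e * Complex.I)
    rw [Complex.ofReal_one] at this
    refine this.congr' ?_
    filter_upwards [hs] with s hs
    rw [ww_eq, ← hs]
    push_cast
    linear_combination (-((√(1 + s^2) : ℝ) : ℂ)  * ((|s| : ℝ) : ℂ)⁻¹ * (-1)) * Complex.I_sq
  have hA : Tendsto (fun s : ℝ => -Complex.I * ww s * (|s|⁻¹ : ℝ)) l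
      (nhds (-(1 + e * Complex.I))) := by
    have := (h1.const_mul 2).sub hB
    rw [Complex.ofReal_zero, mul_zero, zero_sub] at this
    refine this.congr fun s => ?_
    linear_combination (2 * ((|s|⁻¹ : ℝ) : ℂ)) * Complex.I_sq
  have hA' := hA.clog (by
    rw [Complex.mem_slitPlane_iff]; right; simpa using he)
  have hB' := hB.clog (by
    rw [Complex.mem_slitPlane_iff]; right; simpa using he)
  refine (hA'.sub hB').congr' ?_
  filter_upwards [hl.eventually_gt_atTop 0] with s hs
  rw [PP_scale s |s| hs]

lemma PP_top : Tendsto PP atTop (nhds (-(Real.pi * Complex.I))) := by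
  have := PP_lim atTop 1 one_ne_zero tendsto_abs_atTop_atTop (by
    filter_upwards [eventually_gt_atTop 0] with s hs
    rw [abs_of_pos hs, mul_inv_cancel₀ hs.ne'])
  rwa [log_neg_sub _ (by simp)] at this

lemma PP_bot : Tendsto PP atBot (nhds (Real.pi * Complex.I)) := by
  have := PP_lim atBot (-1) (by norm_num) tendsto_abs_atBot_atTop (by
    filter_upwards [eventually_lt_atBot 0] with s hs
    rw [abs_of_neg hs, inv_neg, mul_neg, mul_inv_cancel₀ hs.ne])
  have h2 := log_neg_sub (-(1 + ((-1 : ℝ) : ℂ) * Complex.I)) (by simp)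
  rw [neg_neg] at h2
  rwa [← neg_sub, h2, neg_neg] at this

lemma diff_bound (s : ℝ) : ‖(1 / ww s - 1 / (ww s - 2 * Complex.I)) * gammaC' s‖ ≤
    32 * (1 + ‖s‖) ^ (-2 : ℝ) := by
  have h0 : (0:ℝ) < 1 + |s| := by positivity
  have h1 := ww_norm s
  have h2 := ww_sub_norm s (2 * Complex.I) (by simp) (by simp)
  have h3 := gammaC'_norm s
  have h4 : ww s - 2 * Complex.I ≠ 0 := norm_pos_iff.1 (lt_of_lt_of_le (by positivity) h2)
  have h5 := ww_ne s
  have : 1 / ww s - 1 / (ww s - 2 * Complex.I) = (-2 * Complex.I) / (ww s * (ww s - 2 * Complex.I)) := by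
    field_simp; ring
  rw [this, norm_mul, norm_div, norm_mul, norm_mul, Complex.norm_I, norm_neg, Complex.norm_ofNat]
  calc _ ≤ 2 * 1 / ((1 + |s|) / 4 * ((1 + |s|) / 2)) * 2 := by gcongr
    _ = _ := by
      rw [Real.rpow_neg (by positivity), Real.norm_eq_abs]
      norm_cast
      field_simp
      norm_num

lemma int_bound2 : Integrable (fun s : ℝ => 32 * (1 + ‖s‖) ^ (-2 : ℝ)) :=
  (integrable_one_add_norm (by simp)).const_mul _

lemma diff_cont : Continuous (fun s : ℝ => (1 / ww s - 1 / (ww s - 2 * Complex.I)) * gammaC' s) := by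
  have h4 : ∀ s, ww s - 2 * Complex.I ≠ 0 := fun s => right_ne_zero_of_mul (Complex.slitPlane_ne_zero (slit2 s))
  have := ww_cont; have := gammaC'_cont; have := ww_ne
  fun_prop (disch := first | simpa using h4 | simpa using ww_ne)

lemma diff_integral : ∫ s : ℝ, (1 / ww s - 1 / (ww s - 2 * Complex.I)) * gammaC' s =
    -(2 * Real.pi * Complex.I) := by
  rw [integral_of_hasDerivAt_of_tendsto PP_deriv (int_bound2.mono' diff_cont.aestronglyMeasurable
    (Filter.Eventually.of_forall diff_bound)) PP_bot PP_top]
  ring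

lemma MM_0 (a : ℝ) (ha : 0 < a) : MM 0 a = -(2 * Real.pi * Complex.I) := by
  have hδ : ∀ s, (1/4 : ℝ) ≤ ‖ww s - 0‖ := fun s => by
    have := ww_norm s
    have := abs_nonneg s
    rw [sub_zero]; linarith
  have hδ2 : ∀ s, (1/2 : ℝ) ≤ ‖ww s - 2 * Complex.I‖ := fun s => by
    have := ww_sub_norm s (2 * Complex.I) (by simp) (by simp)
    have := abs_nonneg s
    linarith
  set G : ℝ → ℂ := fun b => ∫ s : ℝ, Complex.exp (-Complex.I * b * ww s) *
    ((1 / ww s - 1 / (ww s - 2 * Complex.I)) * gammaC' s) with hG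
  have h1 : ∀ b : ℝ, 0 < b → G b = MM 0 a := by
    intro b hb
    have i1 := int_M b hb 0 (1/4) (by norm_num) hδ
    have i2 := (int_M b hb (2 * Complex.I) (1/2) (by norm_num) hδ2).const_mul
      (Complex.exp (-Complex.I * b * (2 * Complex.I)))
    have e2 : ∫ s : ℝ, Complex.exp (-Complex.I * b * (2 * Complex.I)) *
        (Complex.exp (-Complex.I * b * (ww s - 2 * Complex.I)) / (ww s - 2 * Complex.I) * gammaC' s) = 0 := by
      rw [integral_const_mul]
      have := MM_zero (2 * Complex.I) (by simp) (by simp) b hb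
      unfold MM at this
      rw [this, mul_zero]
    have := integral_sub i1 i2
    rw [e2, sub_zero] at this
    rw [MM_const 0 (1/4) (by norm_num) hδ a b ha hb, MM, ← this, hG]
    refine integral_congr_ae (Filter.Eventually.of_forall fun s => ?_)
    simp only
    have : Complex.exp (-Complex.I * b * ww s) = Complex.exp (-Complex.I * b * (2 * Complex.I)) *
        Complex.exp (-Complex.I * b * (ww s - 2 * Complex.I)) := by
      rw [← Complex.exp_add]; congr 1; ring
    rw [sub_zero, this]
    ring
  have h2 : Tendsto G (nhdsWithin 0 (Set.Ioi 0)) (nhds (-(2 * Real.pi * Complex.I))) := by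
    rw [← diff_integral, hG]
    refine tendsto_integral_filter_of_dominated_convergence
      (fun s => Real.exp 1 * (32 * (1 + ‖s‖) ^ (-2 : ℝ))) ?_ ?_ (int_bound2.const_mul _) ?_
    · refine Filter.Eventually.of_forall fun b => ?_
      have := ww_cont
      exact (Continuous.mul (by fun_prop) diff_cont).aestronglyMeasurable
    · filter_upwards [Ioo_mem_nhdsGT (zero_lt_one' ℝ)] with b hb
      refine Filter.Eventually.of_forall fun s => ?_
      rw [norm_mul, exp_norm]
      have := diff_bound s
      have h3 : b * (ww s).im ≤ 1 := by
        have := ww_im_le_one s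
        nlinarith [hb.1, hb.2]
      gcongr
    · refine Filter.Eventually.of_forall fun s => ?_
      have : Tendsto (fun b : ℝ => Complex.exp (-Complex.I * b * ww s)) (nhds 0) (nhds 1) := by
        have : Continuous (fun b : ℝ => Complex.exp (-Complex.I * b * ww s)) := by fun_prop
        simpa using this.tendsto 0
      simpa using (this.mono_left nhdsWithin_le_nhds).mul_const
        ((1 / ww s - 1 / (ww s - 2 * Complex.I)) * gammaC' s)
  refine tendsto_nhds_unique (tendsto_const_nhds.congr' ?_) h2
  filter_upwards [self_mem_nhdsWithin] with b hb
  exact (h1 b hb).symm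

/-- the integrand after exchanging -/
noncomputable def FF (lam : ℝ) (s r : ℝ) : ℂ :=
  -(Complex.exp (-Complex.I * (lam * r : ℝ) * ww s) *
    (1 / ww s + r / ((1 - r) * ww s - 2 * Complex.I)) * gammaC' s)

lemma FF_integral (lam : ℝ) (hlam : 0 < lam) (r : ℝ) (hr : r ∈ Set.Ioo (0:ℝ) 1) :
    ∫ s, FF lam s r = 2 * Real.pi * Complex.I := by
  have hb : 0 < lam * r := mul_pos hlam hr.1
  have hr1 : 0 < 1 - r := by linarith [hr.2]
  have hr1' : (1 - r : ℂ) ≠ 0 := by exact_mod_cast hr1.ne'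
  have hδ : ∀ s, (1/4 : ℝ) ≤ ‖ww s - 0‖ := fun s => by
    have := ww_norm s
    have := abs_nonneg s
    rw [sub_zero]; linarith
  set c : ℂ := ((2 / (1 - r) : ℝ) : ℂ) * Complex.I with hc
  have hcr : c.re = 0 := by rw [hc, Complex.re_ofReal_mul]; simp
  have hci : 2 ≤ c.im := by
    have : c.im = 2 / (1 - r) := by rw [hc, Complex.im_ofReal_mul]; simp
    rw [this, le_div_iff₀ hr1]; linarith [hr.1]
  have hδ2 : ∀ s, (1/2 : ℝ) ≤ ‖ww s - c‖ := fun s => by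
    have := ww_sub_norm s c hcr hci
    have := abs_nonneg s
    linarith
  have i1 := int_M _ hb 0 (1/4) (by norm_num) hδ
  have i2 := (int_M _ hb c (1/2) (by norm_num) hδ2).const_mul
      (r / (1 - r) * Complex.exp (-Complex.I * (lam * r : ℝ) * c))
  have e := integral_add i1 i2
  have m1 := MM_0 _ hb
  have m2 := MM_zero c hcr hci _ hb
  unfold MM at m1 m2
  rw [integral_const_mul, m1, m2, mul_zero, add_zero] at e
  unfold FF
  rw [integral_neg, ← neg_inj, neg_neg, ← e]
  refine integral_congr_ae (Filter.Eventually.of_forall fun s => ?_)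
  simp only
  have h5 : Complex.exp (-Complex.I * (lam * r : ℝ) * ww s) =
      Complex.exp (-Complex.I * (lam * r : ℝ) * c) *
        Complex.exp (-Complex.I * (lam * r : ℝ) * (ww s - c)) := by
      rw [← Complex.exp_add]; congr 1; ring
  have h6 : (1 - r) * ww s - 2 * Complex.I = (1 - r) * (ww s - c) := by
    rw [hc]; push_cast; field_simp
  have h7 : ww s - c ≠ 0 := norm_pos_iff.1 (lt_of_lt_of_le (by norm_num) (hδ2 s))
  rw [h6, sub_zero, h5]
  have := ww_ne s
  field_simp

lemma den_norm (s r : ℝ) (hr : r ∈ Set.Ioo (0:ℝ) 1) : 1 ≤ ‖(1 - r) * ww s - 2 * Complex.I‖ := by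
  have h2 := Complex.abs_im_le_norm ((1 - r) * ww s - 2 * Complex.I)
  have h3 := neg_abs_le ((1 - r) * ww s - 2 * Complex.I).im
  have h4 := ww_im_le_one s
  have : ((1 - r) * ww s - 2 * Complex.I).im = (1 - r) * (ww s).im - 2 := by
    simp
  rw [this] at h2 h3
  nlinarith [hr.1, hr.2]

lemma exp_u (lam : ℝ) (hlam : 0 < lam) : ∃ C : ℝ, 0 ≤ C ∧ ∀ u : ℝ, 0 < u →
    Real.exp (-(lam * u)) ≤ C * u ^ (-(1/2) : ℝ) ∧ Real.exp (-(lam * u)) ≤ C * u ^ (-(3/2) : ℝ) := by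
  have key : ∀ p : ℝ, 0 < p → p ≤ 2 → ∀ u : ℝ, 0 < u →
      Real.exp (-(lam * u)) ≤ (1 + 2 / lam ^ 2) * u ^ (-p) := by
    intro p hp hp2 u hu
    have h1 : u ^ p ≤ 1 + u ^ 2 := by
      rcases le_total u 1 with h | h
      · have := Real.rpow_le_one hu.le h hp.le
        nlinarith [sq_nonneg u]
      · have := Real.rpow_le_rpow_of_exponent_le h hp2
        norm_cast at this
        linarith
    have h2 := Real.quadratic_le_exp_of_nonneg (mul_pos hlam hu).le
    have h3 : 1 + u ^ 2 ≤ (1 + 2 / lam ^ 2) * Real.exp (lam * u) := by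
      have : u ^ 2 = 2 / lam ^ 2 * ((lam * u)^2 / 2) := by field_simp
      have h5 : (lam * u)^2 / 2 ≤ Real.exp (lam * u) := by nlinarith [mul_pos hlam hu]
      have h6 : 1 ≤ Real.exp (lam * u) := Real.one_le_exp (mul_pos hlam hu).le
      have h7 : 0 < 2 / lam ^ 2 := by positivity
      nlinarith
    rw [Real.exp_neg, Real.rpow_neg hu.le, ← div_eq_mul_inv, le_div_iff₀ (by positivity),
      inv_mul_le_iff₀ (Real.exp_pos _)]
    linarith
  exact ⟨_, by positivity, fun u hu => ⟨key _ (by norm_num) (by norm_num) u hu,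
    key _ (by norm_num) (by norm_num) u hu⟩⟩

lemma FF_bound (lam : ℝ) (hlam : 0 < lam) : ∃ C : ℝ, ∀ s r : ℝ, r ∈ Set.Ioo (0:ℝ) 1 →
    ‖FF lam s r‖ ≤ C * ((1 + ‖s‖) ^ (-(3/2) : ℝ) * r ^ (-(1/2) : ℝ)) := by
  obtain ⟨C, hC, h⟩ := exp_u lam hlam
  refine ⟨Real.exp (3 * lam) * (4 * C + C) * 2, fun s r hr => ?_⟩
  have hr0 := hr.1
  have hs : 0 < 1 + |s| := by positivity
  set u := r * (1 + |s|) with hu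
  have hu0 : 0 < u := by positivity
  obtain ⟨ha, hb⟩ := h u hu0
  have hE : ‖Complex.exp (-Complex.I * (lam * r : ℝ) * ww s)‖ ≤
      Real.exp (3 * lam) * Real.exp (-(lam * u)) := by
    rw [exp_norm, ← Real.exp_add, Real.exp_le_exp]
    have h1 : lam * r * (ww s).im ≤ lam * r * (2 - |s|) := by
      have := ww_im_le s
      gcongr
    have h2 : lam * r ≤ lam := by nlinarith [hr.2]
    rw [hu]
    nlinarith
  have e1 : Real.exp (-(lam * u)) * (1 / ((1 + |s|)/4)) ≤ 4 * C * ((1 + |s|) ^ (-(3/2) : ℝ) * r ^ (-(1/2) : ℝ)) := by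
    calc _ ≤ C * u ^ (-(1/2) : ℝ) * (1 / ((1 + |s|)/4)) := by gcongr
      _ = _ := by
        rw [hu, Real.mul_rpow hr0.le hs.le, show (-(3/2) : ℝ) = -(1/2) + -1 by norm_num,
          Real.rpow_add hs, Real.rpow_neg_one]
        field_simp
  have e2 : Real.exp (-(lam * u)) * r ≤ C * ((1 + |s|) ^ (-(3/2) : ℝ) * r ^ (-(1/2) : ℝ)) := by
    calc _ ≤ C * u ^ (-(3/2) : ℝ) * r := by gcongr
      _ = _ := by
        rw [hu, Real.mul_rpow hr0.le hs.le, show (-(1/2) : ℝ) = -(3/2) + 1 by norm_num,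
          Real.rpow_add hr0, Real.rpow_one]
        ring
  have hd : ‖1 / ww s + r / ((1 - r) * ww s - 2 * Complex.I)‖ ≤ 1 / ((1 + |s|)/4) + r := by
    refine (norm_add_le _ _).trans ?_
    have h1 := ww_norm s
    have h2 := den_norm s r hr
    rw [norm_div, norm_div, norm_one, Complex.norm_real, Real.norm_of_nonneg hr0.le]
    gcongr
    exact div_le_self hr0.le h2
  unfold FF
  rw [norm_neg, norm_mul, norm_mul, Real.norm_eq_abs]
  have h3 := gammaC'_norm s
  calc _ ≤ (Real.exp (3 * lam) * Real.exp (-(lam * u))) * (1 / ((1 + |s|)/4) + r) * 2 := by gcongr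
    _ = Real.exp (3 * lam) * (Real.exp (-(lam * u)) * (1 / ((1 + |s|)/4)) + Real.exp (-(lam * u)) * r) * 2 := by ring
    _ ≤ Real.exp (3 * lam) * (4 * C * ((1 + |s|) ^ (-(3/2) : ℝ) * r ^ (-(1/2) : ℝ)) + C * ((1 + |s|) ^ (-(3/2) : ℝ) * r ^ (-(1/2) : ℝ))) * 2 := by gcongr
    _ = _ := by ring

lemma FF_integrable (lam : ℝ) (hlam : 0 < lam) :
    Integrable (Function.uncurry (FF lam))
      ((volume : Measure ℝ).prod (volume.restrict (Set.Ioo (0:ℝ) 1))) := by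
  obtain ⟨C, h⟩ := FF_bound lam hlam
  have i1 : Integrable (fun s : ℝ => (1 + ‖s‖) ^ (-(3/2) : ℝ)) :=
    integrable_one_add_norm (by norm_num)
  have i2 : Integrable (fun r : ℝ => r ^ (-(1/2) : ℝ)) (volume.restrict (Set.Ioo (0:ℝ) 1)) := by
    have := intervalIntegral.intervalIntegrable_rpow' (a := 0) (b := 1) (r := -(1/2)) (by norm_num)
    rw [intervalIntegrable_iff_integrableOn_Ioo_of_le zero_le_one] at this
    exact this
  refine ((i1.mul_prod i2).const_mul C).mono' ?_ ?_
  · have h1 := ww_cont.measurable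
    have h2 := gammaC'_cont.measurable
    apply Measurable.aestronglyMeasurable
    unfold FF Function.uncurry
    fun_prop
  · have hm : ∀ᵐ p : ℝ × ℝ ∂((volume : Measure ℝ).prod (volume.restrict (Set.Ioo (0:ℝ) 1))),
        p.2 ∈ Set.Ioo (0:ℝ) 1 :=
      Measure.quasiMeasurePreserving_snd.ae (ae_restrict_mem measurableSet_Ioo)
    filter_upwards [hm] with p hp
    exact h p.1 p.2 hp

lemma integrand_eq (lam s : ℝ) :
    ((gammaC s - Complex.I) / (gammaC s + Complex.I) ^ 2) *
      Complex.exp (-Complex.I * lam * gammaC s) * innerInt lam (gammaC s) * gammaC' s =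
    ∫ r in Set.Ioo (0:ℝ) 1, FF lam s r := by
  unfold innerInt
  rw [intervalIntegral.integral_of_le zero_le_one, integral_Ioc_eq_integral_Ioo,
    ← integral_const_mul, ← integral_mul_const]
  refine setIntegral_congr_fun measurableSet_Ioo fun r hr => ?_
  have hg : gammaC s = ww s - Complex.I := by simp [ww]
  have h1 := ww_ne s
  have h2 : (1 - r) * ww s - 2 * Complex.I ≠ 0 :=
    norm_pos_iff.1 (lt_of_lt_of_le (by norm_num) (den_norm s r hr))
  have hE : Complex.exp (-Complex.I * (lam * r : ℝ) * ww s) =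
      Complex.exp (-Complex.I * lam * (ww s - Complex.I)) *
        Complex.exp (Complex.I * lam * (ww s - Complex.I - r * ww s)) := by
    rw [← Complex.exp_add]; congr 1; push_cast; ring
  have hd : 1 / ww s + r / ((1 - r) * ww s - 2 * Complex.I) =
      (ww s - 2 * Complex.I) / (ww s * ((1 - r) * ww s - 2 * Complex.I)) := by
    rw [div_add_div _ _ h1 h2]; congr 1; ring
  have h3 : ww s - Complex.I - r * ww s - Complex.I = (1 - r) * ww s - 2 * Complex.I := by ring
  simp only [FF]
  rw [hg, sub_add_cancel, hE, hd, h3, show ww s - Complex.I - Complex.I = ww s - 2 * Complex.I by ring]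
  field_simp

/-- `n(λ) = -i ∫_C (x-i)/(x+i)² e^{-iλx} (∫_x^{-i} e^{iλz}/(z-i) dz) dx = 2π`. -/
theorem stmt7 (lam : ℝ) (hlam : 0 < lam) :
    (-Complex.I * ∫ s : ℝ,
        ((gammaC s - Complex.I) / (gammaC s + Complex.I) ^ 2) *
            Complex.exp (-Complex.I * lam * gammaC s) * innerInt lam (gammaC s) * gammaC' s)
      = 2 * Real.pi := by
  simp_rw [integrand_eq]
  rw [integral_integral_swap (FF_integrable lam hlam),
    setIntegral_congr_fun measurableSet_Ioo (fun r hr => FF_integral lam hlam r hr)]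
  simp
  linear_combination (-2 * (Real.pi : ℂ)) * Complex.I_sq
end

section
/- Fix λ > 0. Define m₋(x,λ) := [(x+i)/(x−i)] e^{iλx} · (∫_x^i e^{−iλz}/(z+i) dz)/(∫_{−∞}^i e^{−iλz}/(z+i) dz), where the numerator is along the segment from x ∈ ℝ to i and the denominator is an improper contour integral in the closed upper half-plane. Then the denominator equals e^{−λ}(−iπ + Ei(2λ)) and in particular is nonzero, and m₋(x,λ)e^{−iλx} → 1 as x → −∞. -/
open MeasureTheory Complex Filter Set

/-- The denominator `∫_{-∞}^i e^{-iλz}/(z+i) dz`, along the horizontal path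
`z = s + i`, `s` from `-∞` to `0`, in the closed upper half-plane (improper integral). -/
noncomputable def denomInt (lam : ℝ) : ℂ :=
  limUnder atTop
    (fun R : ℝ => ∫ s : ℝ in (-R)..0,
      Complex.exp (-Complex.I * lam * ((s : ℂ) + Complex.I)) / (((s : ℂ) + Complex.I) + Complex.I))

/-- The numerator `∫_x^i e^{-iλz}/(z+i) dz` along the segment from `x ∈ ℝ` to `i`,
parametrized by `z = x + r(i - x)`, `0 ≤ r ≤ 1`. -/
noncomputable def numerInt (lam : ℝ) (x : ℝ) : ℂ :=
  ∫ r : ℝ in (0)..1,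
    Complex.exp (-Complex.I * lam * ((x : ℂ) + r * (Complex.I - x))) /
        (((x : ℂ) + r * (Complex.I - x)) + Complex.I) * (Complex.I - (x : ℂ))

/-- The Jost solution `m₋(x,λ)`. -/
noncomputable def mMinus (lam : ℝ) (x : ℝ) : ℂ :=
  (((x : ℂ) + Complex.I) / ((x : ℂ) - Complex.I)) * Complex.exp (Complex.I * lam * x) *
    (numerInt lam x / denomInt lam)

lemma aux_G : ∃ (G : ℂ → ℂ) (g : ℝ → ℝ), (∀ w : ℂ, w ≠ 0 → HasDerivAt G ((Complex.exp w - 1) / w) w) ∧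
    (Continuous g) ∧ ∀ x : ℝ, G x = g x := by
  have hd : Differentiable ℂ (dslope Complex.exp 0) := by
    rw [← differentiableOn_univ, Complex.differentiableOn_dslope Filter.univ_mem]
    exact Complex.differentiable_exp.differentiableOn
  obtain ⟨G0, hG0⟩ := hd.isExactOn_univ
  have hval : ∀ w : ℂ, w ≠ 0 → dslope Complex.exp 0 w = (Complex.exp w - 1) / w := by
    intro w hw
    rw [dslope_of_ne _ hw, slope_def_field]; simp
  have hre : ∀ x : ℝ, (dslope Complex.exp 0 (x : ℂ)).im = 0 := by
    intro x
    by_cases hx : x = 0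
    · subst hx; simp [dslope_same]
    · rw [hval _ (by exact_mod_cast hx)]
      have : (Complex.exp x - 1) / (x : ℂ) = (((Real.exp x - 1) / x : ℝ) : ℂ) := by push_cast; rfl
      rw [this, Complex.ofReal_im]
  have hG : ∀ w : ℂ, HasDerivAt (fun w => G0 w - G0 0) (dslope Complex.exp 0 w) w := fun w =>
    (hG0 w (Set.mem_univ _)).sub_const _
  set G : ℂ → ℂ := fun w => G0 w - G0 0 with hGdef
  have him : ∀ x : ℝ, (G x).im = 0 := by
    have hder : ∀ x : ℝ, HasDerivAt (fun x : ℝ => (G x).im) 0 x := by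
      intro x
      have h1 := ((hG x).const_mul (-Complex.I)).real_of_complex
      have e : (-Complex.I * dslope Complex.exp 0 (x : ℂ)).re = 0 := by
        simp [Complex.mul_re, hre x]
      rw [e] at h1
      convert h1 using 2 with y
      simp [Complex.mul_re]
    intro x
    have := is_const_of_deriv_eq_zero (fun y => (hder y).differentiableAt) (fun y => (hder y).deriv) x 0
    rw [this]; simp [hGdef]
  refine ⟨G, fun x => (G x).re, fun w hw => hval w hw ▸ hG w, ?_, ?_⟩
  · have : Continuous G := continuous_iff_continuousAt.2 fun w => (hG w).continuousAt
    fun_prop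
  · intro x
    apply Complex.ext <;> simp [him x]

lemma aux_Ei_s8 (g : ℝ → ℝ) (hg : Continuous g) 
    (hg' : ∀ x : ℝ, x ≠ 0 → HasDerivAt g ((Real.exp x - 1) / x) x) :
    ∃ L : ℝ, Tendsto (fun x => Real.log x + g x) atBot (nhds L) ∧
      ∀ k, 0 < k → Ei k = Real.log k + g k - L := by
  have hH : ∀ x : ℝ, x ≠ 0 → HasDerivAt (fun x => Real.log x + g x) (Real.exp x / x) x := by
    intro x hx
    refine HasDerivAt.congr_deriv ((Real.hasDerivAt_log hx).add (hg' x hx)) ?_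
    field_simp; ring
  have hint : ∀ δ : ℝ, 0 < δ → IntegrableOn (fun s => Real.exp s / s) (Set.Iic (-δ)) := by
    intro δ hδ
    have h1 : IntegrableOn (fun s => δ⁻¹ * Real.exp s) (Set.Iic (-δ)) := 
      (integrableOn_exp_Iic _).const_mul _
    refine Integrable.mono' h1 ?_ ?_
    · exact (Real.measurable_exp.div measurable_id).aestronglyMeasurable
    · refine (ae_restrict_iff' measurableSet_Iic).2 (Eventually.of_forall fun s hs => ?_)
      have hs' : s ≤ -δ := hs
      rw [norm_div, Real.norm_eq_abs, Real.norm_eq_abs, abs_of_pos (Real.exp_pos s), 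
        abs_of_neg (by linarith), div_eq_inv_mul]
      gcongr
      linarith
  have hsub : ∀ x y : ℝ, (∀ z ∈ Set.uIcc x y, z ≠ 0) → 
      ∫ s in x..y, Real.exp s / s = (Real.log y + g y) - (Real.log x + g x) := by
    intro x y hxy
    apply intervalIntegral.integral_eq_sub_of_hasDerivAt (fun z hz => hH z (hxy z hz))
    apply ContinuousOn.intervalIntegrable
    exact Real.continuous_exp.continuousOn.div continuousOn_id hxy
  have hL : Tendsto (fun x => Real.log x + g x) atBot 
      (nhds ((Real.log (-1) + g (-1)) - ∫ s in Set.Iic (-1), Real.exp s / s)) := by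
    have h := (intervalIntegral_tendsto_integral_Iic (-1) (hint 1 one_pos) tendsto_id).const_sub 
      (Real.log (-1) + g (-1))
    refine h.congr' ?_
    filter_upwards [Iic_mem_atBot (-1 : ℝ)] with x hx
    have hx : x ≤ -1 := hx
    rw [id, hsub x (-1)]
    · ring
    · intro z hz
      rw [Set.uIcc_of_le hx] at hz
      linarith [hz.2]
  refine ⟨_, hL, ?_⟩
  set L := (Real.log (-1) + g (-1)) - ∫ s in Set.Iic (-1), Real.exp s / s
  intro k hk
  apply Tendsto.limUnder_eq
  have h2 : Tendsto (fun δ : ℝ => g (-δ) - g δ + (Real.log k + g k - L)) (nhdsWithin 0 (Set.Ioi 0)) 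
      (nhds (Real.log k + g k - L)) := by
    have : Continuous (fun δ : ℝ => g (-δ) - g δ + (Real.log k + g k - L)) := by fun_prop
    have h3 := this.tendsto 0
    simp only [neg_zero, sub_self, zero_add] at h3
    exact h3.mono_left nhdsWithin_le_nhds
  refine h2.congr' ?_
  filter_upwards [self_mem_nhdsWithin] with δ hδ
  have hδ : 0 < δ := hδ
  rw [hsub δ k, integral_Iic_of_hasDerivAt_of_tendsto' (f := fun x => Real.log x + g x) (m := L) _ (hint δ hδ) hL]
  · simp only [Real.log_neg_eq_log]; ring
  · intro x hx
    have : x ≤ -δ := hx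
    exact hH x (by linarith)
  · intro z hz
    have := (Set.uIcc_subset_Icc (a₁ := δ) (b₁ := k) (a₂ := min δ k) (b₂ := max δ k) (by simp) (by simp)) hz
    have h4 : 0 < min δ k := lt_min hδ hk
    linarith [this.1]

lemma aux_F (G : ℂ → ℂ) (hG : ∀ w : ℂ, w ≠ 0 → HasDerivAt G ((Complex.exp w - 1) / w) w)
    (w : ℂ) (hw : 0 < w.im ∨ w.re ≠ 0) :
    HasDerivAt (fun w => Complex.log (-Complex.I * w) + Complex.I * Real.pi / 2 + G w) 
      (Complex.exp w / w) w := by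
  have hw0 : w ≠ 0 := by
    rintro rfl
    simp at hw
  have hs : -Complex.I * w ∈ Complex.slitPlane := by
    rw [Complex.mem_slitPlane_iff]
    simpa using hw
  have h1 := ((hasDerivAt_id w).const_mul (-Complex.I)).clog hs
  refine HasDerivAt.congr_deriv ((h1.add_const (Complex.I * Real.pi / 2)).add (hG w hw0)) ?_
  have := Complex.I_ne_zero
  simp only [id]
  field_simp
  ring

lemma aux_line (F : ℂ → ℂ) 
    (hF : ∀ w : ℂ, (0 < w.im ∨ w.re ≠ 0) → HasDerivAt F (Complex.exp w / w) w) (c d : ℂ) (a b : ℝ)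
    (h : ∀ t ∈ Set.uIcc a b, 0 < (c + (t : ℂ) * d).im ∨ (c + (t : ℂ) * d).re ≠ 0) :
    ∫ t in a..b, Complex.exp (c + (t : ℂ) * d) / (c + (t : ℂ) * d) * d = F (c + b * d) - F (c + a * d) := by
  apply intervalIntegral.integral_eq_sub_of_hasDerivAt (f := fun t : ℝ => F (c + t * d))
  · intro t ht
    have h1 : HasDerivAt (fun t : ℝ => c + (t : ℂ) * d) d t := by
      simpa using ((Complex.ofRealCLM.hasDerivAt (x := t)).mul_const d).const_add c
    exact (hF _ (h t ht)).comp t h1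
  · apply ContinuousOn.intervalIntegrable
    refine ContinuousOn.mul (ContinuousOn.div (by fun_prop) (by fun_prop) ?_) (by fun_prop)
    intro t ht h0
    have := h t ht
    rw [h0] at this
    simp at this

lemma aux_lim (F : ℂ → ℂ) 
    (hF : ∀ w : ℂ, (0 < w.im ∨ w.re ≠ 0) → HasDerivAt F (Complex.exp w / w) w) (M : ℂ)
    (hM : Tendsto (fun T : ℝ => F (-(T : ℂ))) atTop (nhds M)) (a : ℝ) (ha : 0 < a) :
    Tendsto (fun T : ℝ => F (a + T * Complex.I)) atTop (nhds M) := by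
  have key : Tendsto (fun T : ℝ => F (a + T * Complex.I) - F (-(T : ℂ))) atTop (nhds 0) := by
    have hlim : Tendsto (fun T : ℝ => 12 * Real.exp a / T) atTop (nhds 0) :=
      tendsto_const_nhds.div_atTop tendsto_id
    refine squeeze_zero_norm' ?_ hlim
    filter_upwards [eventually_ge_atTop (4 * a)] with T hT
    have hT0 : 0 < T := by linarith
    set d : ℂ := (a + T : ℝ) + T * Complex.I with hd
    have hre : ∀ t : ℝ, (-(T : ℂ) + t * d).re = -T + t * (a + T) := by
      intro t; simp [hd]
    have him : ∀ t : ℝ, (-(T : ℂ) + t * d).im = t * T := by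
      intro t; simp [hd]
    have hl := aux_line F hF (-(T : ℂ)) d 0 1 (by
      intro t ht
      rw [Set.uIcc_of_le zero_le_one] at ht
      rw [hre, him]
      rcases ht.1.eq_or_lt with h0 | h0
      · right; rw [← h0]; linarith
      · left; positivity)
    have e1 : -(T : ℂ) + (1 : ℝ) * d = a + T * Complex.I := by
      rw [hd]; push_cast; ring
    have e0 : -(T : ℂ) + (0 : ℝ) * d = -(T : ℂ) := by simp
    rw [e1, e0] at hl
    rw [← hl]
    have hdn : ‖d‖ ≤ 3 * T := by
      calc ‖d‖ ≤ ‖((a + T : ℝ) : ℂ)‖ + ‖(T : ℂ) * Complex.I‖ := norm_add_le _ _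
        _ = (a + T) + T := by
          rw [norm_mul, Complex.norm_I, mul_one, Complex.norm_real, Complex.norm_real, 
            Real.norm_of_nonneg hT0.le, Real.norm_of_nonneg (by linarith)]
        _ ≤ 3 * T := by linarith
    have hbd : ‖∫ t in (0:ℝ)..1, Complex.exp (-(T : ℂ) + (t : ℂ) * d) / (-(T : ℂ) + (t : ℂ) * d) * d‖ 
        ≤ ∫ t in (0:ℝ)..1, 12 * Real.exp (-T + t * (a + T)) := by
      apply intervalIntegral.norm_integral_le_of_norm_le zero_le_one
      · refine Eventually.of_forall fun t ht => ?_
        rw [norm_mul, norm_div, Complex.norm_exp, hre]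
        have hw : T / 4 ≤ ‖-(T : ℂ) + (t : ℂ) * d‖ := by
          have h1 := Complex.abs_re_le_norm (-(T : ℂ) + (t : ℂ) * d)
          have h2 := Complex.abs_im_le_norm (-(T : ℂ) + (t : ℂ) * d)
          rw [hre] at h1
          rw [him] at h2
          have h3 := neg_abs_le (-T + t * (a + T))
          have h4 := le_abs_self (t * T)
          nlinarith [ht.1, ht.2]
        calc _ ≤ Real.exp (-T + t * (a + T)) / (T / 4) * (3 * T) := by gcongr
          _ = 12 * Real.exp (-T + t * (a + T)) := by field_simp; ring
      · apply Continuous.intervalIntegrable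
        fun_prop
    refine hbd.trans ?_
    have haT : a + T ≠ 0 := by linarith
    have hint : ∫ t in (0:ℝ)..1, 12 * Real.exp (-T + t * (a + T)) = 
        12 * Real.exp (-T + 1 * (a + T)) / (a + T) - 12 * Real.exp (-T + 0 * (a + T)) / (a + T) := by
      apply intervalIntegral.integral_eq_sub_of_hasDerivAt 
        (f := fun t => 12 * Real.exp (-T + t * (a + T)) / (a + T))
      · intro t _
        have h1 : HasDerivAt (fun t : ℝ => -T + t * (a + T)) (a + T) t := by
          simpa using ((hasDerivAt_id t).mul_const (a + T)).const_add (-T)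
        refine HasDerivAt.congr_deriv ((h1.exp.const_mul 12).div_const (a + T)) ?_
        field_simp
      · apply Continuous.intervalIntegrable
        fun_prop
    rw [hint]
    have e2 : -T + 1 * (a + T) = a := by ring
    rw [e2]
    have h5 : 0 ≤ 12 * Real.exp (-T + 0 * (a + T)) / (a + T) := by positivity
    have h6 : 12 * Real.exp a / (a + T) ≤ 12 * Real.exp a / T := by
      gcongr
      linarith
    linarith
  simpa using key.add hM

/-- The denominator equals `e^{-λ}(-iπ + Ei(2λ)) ≠ 0`, and `m₋(x,λ)e^{-iλx} → 1` as `x → -∞`. -/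
theorem stmt8 (lam : ℝ) (hlam : 0 < lam) :
    denomInt lam = Real.exp (-lam) * (-(Real.pi : ℂ) * Complex.I + (Ei (2 * lam) : ℝ)) ∧
    denomInt lam ≠ 0 ∧
    Tendsto (fun x : ℝ => mMinus lam x * Complex.exp (-Complex.I * lam * x)) atBot (nhds 1) := by
  obtain ⟨G, g, hG, hg, hGg⟩ := aux_G
  have hg' : ∀ x : ℝ, x ≠ 0 → HasDerivAt g ((Real.exp x - 1) / x) x := by
    intro x hx
    have h := (hG x (by exact_mod_cast hx)).real_of_complex
    have e : ((Complex.exp x - 1) / (x : ℂ)) = (((Real.exp x - 1) / x : ℝ) : ℂ) := by push_cast; rfl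
    rw [e, Complex.ofReal_re] at h
    convert h using 2 with y
    simp [hGg]
  obtain ⟨L, hL, hEi⟩ := aux_Ei_s8 g hg hg'
  have hF := aux_F G hG
  set F : ℂ → ℂ := fun w => Complex.log (-Complex.I * w) + Complex.I * Real.pi / 2 + G w with hFdef
  have hFpos : ∀ x : ℝ, 0 < x → F x = Real.log x + g x := by
    intro x hx
    simp only [hFdef, hGg]
    rw [mul_comm, Complex.log_ofReal_mul hx (by simp), Complex.log_neg_I]
    ring
  have hFneg : ∀ x : ℝ, 0 < x → F (-(x : ℂ)) = ((Real.log (-x) + g (-x) : ℝ) : ℂ) + Real.pi * Complex.I := by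
    intro x hx
    have := hGg (-x)
    push_cast at this
    simp only [hFdef, this]
    rw [show -Complex.I * -(x : ℂ) = x * Complex.I by ring, Complex.log_ofReal_mul hx (by simp), 
      Complex.log_I, Real.log_neg_eq_log]
    push_cast
    ring
  have hM : Tendsto (fun T : ℝ => F (-(T : ℂ))) atTop (nhds (L + Real.pi * Complex.I)) := by
    have h1 : Tendsto (fun T : ℝ => ((Real.log (-T) + g (-T) : ℝ) : ℂ) + Real.pi * Complex.I) atTop 
        (nhds (L + Real.pi * Complex.I)) :=
      ((Complex.continuous_ofReal.tendsto L).comp (hL.comp tendsto_neg_atTop_atBot)).add_const _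
    refine h1.congr' ?_
    filter_upwards [eventually_gt_atTop 0] with T hT
    exact (hFneg T hT).symm
  have hlim := aux_lim F hF _ hM
  have hlamC : (lam : ℂ) ≠ 0 := by exact_mod_cast hlam.ne'
  -- value of the common limit
  set D : ℂ := Real.exp (-lam) * (-(Real.pi : ℂ) * Complex.I + (Ei (2 * lam) : ℝ)) with hD
  have hDF : D = Real.exp (-lam) * (F ((2 * lam : ℝ) : ℂ) - (L + Real.pi * Complex.I)) := by
    rw [hD, hFpos _ (by linarith), hEi _ (by linarith)]
    push_cast
    ring
  have hrw : ∀ z : ℂ, Complex.exp (-Complex.I * lam * z) / (z + Complex.I) = 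
      Real.exp (-lam) * (Complex.exp (-Complex.I * lam * (z + Complex.I)) / 
        (-Complex.I * lam * (z + Complex.I)) * (-Complex.I * lam)) := by
    intro z
    have e : -Complex.I * lam * z = ((-lam : ℝ) : ℂ) + -Complex.I * lam * (z + Complex.I) := by
      push_cast
      linear_combination (lam : ℂ) * Complex.I_mul_I
    have hne : -Complex.I * (lam : ℂ) ≠ 0 := mul_ne_zero (neg_ne_zero.2 Complex.I_ne_zero) hlamC
    rw [e, Complex.exp_add, Complex.ofReal_exp]
    by_cases hz : z + Complex.I = 0
    · simp [hz]
    · generalize -Complex.I * (lam : ℂ) = q at *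
      field_simp
  have hden : denomInt lam = D := by
    apply Tendsto.limUnder_eq
    have h1 : Tendsto (fun R : ℝ => (Real.exp (-lam) : ℂ) * (F ((2 * lam : ℝ) : ℂ) - 
        F ((2 * lam : ℝ) + ((lam * R : ℝ) : ℂ) * Complex.I))) atTop (nhds D) := by
      rw [hDF]
      exact (((hlim (2 * lam) (by linarith)).comp 
        (tendsto_id.const_mul_atTop hlam)).const_sub _).const_mul _
    refine h1.congr fun R => ?_
    have hl := aux_line F hF ((2 * lam : ℝ) : ℂ) (-Complex.I * lam) (-R) 0 (by
      intro t _
      right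
      simp [hlam.ne'])
    have e0 : ((2 * lam : ℝ) : ℂ) + ((0 : ℝ) : ℂ) * (-Complex.I * lam) = ((2 * lam : ℝ) : ℂ) := by simp
    have e1 : ((2 * lam : ℝ) : ℂ) + ((-R : ℝ) : ℂ) * (-Complex.I * lam) = 
        (2 * lam : ℝ) + ((lam * R : ℝ) : ℂ) * Complex.I := by push_cast; ring
    rw [e0, e1] at hl
    rw [← hl, ← intervalIntegral.integral_const_mul]
    congr 1
    funext s
    rw [hrw]
    have e2 : -Complex.I * lam * ((s : ℂ) + Complex.I + Complex.I) = 
        ((2 * lam : ℝ) : ℂ) + (s : ℂ) * (-Complex.I * lam) := by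
      push_cast
      linear_combination (-2 * lam : ℂ) * Complex.I_mul_I
    rw [e2]
  have hD0 : D ≠ 0 := by
    rw [hD]
    refine mul_ne_zero (by exact_mod_cast (Real.exp_pos _).ne') ?_
    intro h
    have := congrArg Complex.im h
    simp [Real.pi_ne_zero] at this
  have hnum : Tendsto (fun x : ℝ => numerInt lam x) atBot (nhds D) := by
    have h1 : Tendsto (fun x : ℝ => (Real.exp (-lam) : ℂ) * (F ((2 * lam : ℝ) : ℂ) - 
        F ((lam : ℝ) + ((lam * (-x) : ℝ) : ℂ) * Complex.I))) atBot (nhds D) := by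
      rw [hDF]
      exact (((hlim lam hlam).comp 
        (tendsto_neg_atBot_atTop.const_mul_atTop hlam)).const_sub _).const_mul _
    refine h1.congr fun x => ?_
    have hl := aux_line F hF ((lam : ℝ) + ((lam * (-x) : ℝ) : ℂ) * Complex.I) 
      (-Complex.I * lam * (Complex.I - x)) 0 1 (by
      intro t ht
      rw [Set.uIcc_of_le zero_le_one] at ht
      right
      have e : ((lam : ℝ) + ((lam * (-x) : ℝ) : ℂ) * Complex.I + 
        (t : ℂ) * (-Complex.I * lam * (Complex.I - x))).re = lam + t * lam := by
        simp
      rw [e]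
      have := ht.1
      positivity)
    have e0 : ((lam : ℝ) + ((lam * (-x) : ℝ) : ℂ) * Complex.I) + 
      ((1 : ℝ) : ℂ) * (-Complex.I * lam * (Complex.I - x)) = ((2 * lam : ℝ) : ℂ) := by 
      push_cast
      linear_combination (-lam : ℂ) * Complex.I_mul_I
    rw [e0, Complex.ofReal_zero, zero_mul, add_zero] at hl
    rw [← hl, ← intervalIntegral.integral_const_mul, numerInt]
    congr 1
    funext s
    rw [hrw]
    have e2 : -Complex.I * lam * ((x : ℂ) + s * (Complex.I - x) + Complex.I) = 
        ((lam : ℝ) + ((lam * (-x) : ℝ) : ℂ) * Complex.I) + 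
          (s : ℂ) * (-Complex.I * lam * (Complex.I - x)) := by
      push_cast
      linear_combination (-lam : ℂ) * Complex.I_mul_I
    rw [e2]
    ring
  refine ⟨hden, hden ▸ hD0, ?_⟩
  have hfrac : Tendsto (fun x : ℝ => ((x : ℂ) + Complex.I) / ((x : ℂ) - Complex.I)) atBot (nhds 1) := by
    have hz : Tendsto (fun x : ℝ => 2 * Complex.I / ((x : ℂ) - Complex.I)) atBot (nhds 0) := by
      have hb : Tendsto (fun x : ℝ => 2 / (-x)) atBot (nhds 0) := 
        tendsto_const_nhds.div_atTop tendsto_neg_atBot_atTop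
      refine squeeze_zero_norm' ?_ hb
      filter_upwards [eventually_lt_atBot 0] with x hx
      rw [norm_div]
      have h1 := Complex.abs_re_le_norm ((x : ℂ) - Complex.I)
      simp only [Complex.sub_re, Complex.ofReal_re, Complex.I_re, sub_zero, abs_of_neg hx] at h1
      have h2 : ‖2 * Complex.I‖ = 2 := by simp
      rw [h2]
      have : 0 < -x := by linarith
      gcongr
    have h3 := hz.const_add 1
    rw [add_zero] at h3
    refine h3.congr fun x => ?_
    have hne : (x : ℂ) - Complex.I ≠ 0 := by
      intro h
      have := congrArg Complex.im h
      simp at this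
    field_simp
    ring
  have hfin := hfrac.mul (hnum.div_const D)
  rw [div_self hD0, one_mul] at hfin
  refine hfin.congr fun x => ?_
  rw [mMinus, hden]
  have e : Complex.exp (Complex.I * lam * x) * Complex.exp (-Complex.I * lam * x) = 1 := by
    rw [← Complex.exp_add]
    simp
  linear_combination (-(((x : ℂ) + Complex.I) / ((x : ℂ) - Complex.I)) * (numerInt lam x / D)) * e
end
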